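/- Let d ≥ 1, p ≥ 2, q > 0 and α, c > 0, and consider the Ogden-type elastic energy W_el(F) = (α/p)‖F‖^p + (c/q)(det F)^{−q}, where ‖·‖ denotes the Frobenius norm on d×d real matrices, defined for F with det F > 0, and let K(A) = α‖A‖^{p−2} A Aᵀ − c (det A)^{−q} I. Then for every ε > 0 there exists δ > 0 such that for all d×d real matrices A, B with det A > 0 and ‖B − I‖ ≤ δ (which forces det B > 0), one has ‖K(B A) − K(A)‖ ≤ ε (1 + W_el(A)). -/

import Mathlib

open Matrix

/-- Frobenius norm of a real `d × d` matrix. -/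
noncomputable def fnorm {d : ℕ} (F : Matrix (Fin d) (Fin d) ℝ) : ℝ :=
  Real.sqrt (∑ i, ∑ j, (F i j) ^ 2)

/-- Ogden-type elastic energy `W_el(F) = (α/p)‖F‖^p + (c/q)(det F)^{-q}`. -/
noncomputable def Wel {d : ℕ} (p q α c : ℝ) (F : Matrix (Fin d) (Fin d) ℝ) : ℝ :=
  (α / p) * fnorm F ^ p + (c / q) * F.det ^ (-q)

/-- Kirchhoff-type stress `K(A) = α‖A‖^{p−2} A Aᵀ − c (det A)^{−q} I` of the
Ogden-type energy. -/
noncomputable def Kstress {d : ℕ} (p q α c : ℝ) (A : Matrix (Fin d) (Fin d) ℝ) :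
    Matrix (Fin d) (Fin d) ℝ :=
  (α * fnorm A ^ (p - 2)) • (A * Aᵀ) - (c * A.det ^ (-q)) • (1 : Matrix (Fin d) (Fin d) ℝ)

section

attribute [local instance] Matrix.frobeniusNormedAddCommGroup Matrix.frobeniusNormedSpace

open Topology Filter

theorem fnorm_eq_norm {d : ℕ} (F : Matrix (Fin d) (Fin d) ℝ) : fnorm F = ‖F‖ := by
  rw [fnorm, Matrix.frobenius_norm_def, Real.sqrt_eq_rpow]
  simp

theorem continuous_norm_rpow_smul_mul_transpose {d : ℕ} {r : ℝ} (hr : 0 ≤ r) :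
    Continuous fun F : Matrix (Fin d) (Fin d) ℝ => ‖F‖ ^ r • (F * Fᵀ) :=
  (continuous_norm.rpow_const fun _ => Or.inr hr).smul
    (continuous_id.matrix_mul continuous_id.matrix_transpose)

/-- Uniform continuity at `B = 1` of `B ↦ ‖B U‖ ^ r • (B U) (B U)ᵀ`, for `U` on the unit sphere. -/
theorem eventually_norm_sub_le_of_norm_eq_one {d : ℕ} {r η : ℝ} (hr : 0 ≤ r) (hη : 0 < η) :
    ∀ᶠ B : Matrix (Fin d) (Fin d) ℝ in 𝓝 1, ∀ U : Matrix (Fin d) (Fin d) ℝ, ‖U‖ = 1 →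
      ‖‖B * U‖ ^ r • ((B * U) * (B * U)ᵀ) - ‖U‖ ^ r • (U * Uᵀ)‖ ≤ η := by
  have : ProperSpace (Matrix (Fin d) (Fin d) ℝ) := FiniteDimensional.proper ℝ _
  have key := (isCompact_sphere (0 : Matrix (Fin d) (Fin d) ℝ)
    1).eventually_forall_of_forall_eventually (x₀ := (1 : Matrix (Fin d) (Fin d) ℝ))
    (P := fun B U => ‖‖B * U‖ ^ r • ((B * U) * (B * U)ᵀ) - ‖U‖ ^ r • (U * Uᵀ)‖ < η) ?_
  · filter_upwards [key] with B hB U hU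
    exact (hB U (by simpa using hU)).le
  · intro U _
    have hg := continuous_norm_rpow_smul_mul_transpose (d := d) hr
    have hmul : Continuous fun z : Matrix (Fin d) (Fin d) ℝ × Matrix (Fin d) (Fin d) ℝ =>
        z.1 * z.2 := continuous_fst.matrix_mul continuous_snd
    have hc := ((hg.comp hmul).sub (hg.comp continuous_snd)).norm
    have ht := hc.continuousAt (x := ((1 : Matrix (Fin d) (Fin d) ℝ), U))
    exact ht.eventually_lt_const (by simpa using hη)

theorem norm_rpow_smul_mul_transpose_smul {d : ℕ} {r s : ℝ} (hs : 0 < s)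
    (F : Matrix (Fin d) (Fin d) ℝ) :
    ‖s • F‖ ^ r • ((s • F) * (s • F)ᵀ) = s ^ (r + 2) • (‖F‖ ^ r • (F * Fᵀ)) := by
  rw [norm_smul, Real.norm_of_nonneg hs.le, Real.mul_rpow hs.le (norm_nonneg F),
    Real.rpow_add hs, Real.rpow_two]
  simp only [Matrix.transpose_smul, Matrix.smul_mul, Matrix.mul_smul, smul_smul]
  congr 1
  ring

theorem eventually_norm_sub_le {d : ℕ} {r η : ℝ} (hr : 0 ≤ r) (hη : 0 < η) :
    ∀ᶠ B : Matrix (Fin d) (Fin d) ℝ in 𝓝 1, ∀ A : Matrix (Fin d) (Fin d) ℝ,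
      ‖‖B * A‖ ^ r • ((B * A) * (B * A)ᵀ) - ‖A‖ ^ r • (A * Aᵀ)‖ ≤ η * ‖A‖ ^ (r + 2) := by
  filter_upwards [eventually_norm_sub_le_of_norm_eq_one hr hη] with B hB A
  rcases eq_or_ne A 0 with rfl | hA
  · simpa using mul_nonneg hη.le (Real.rpow_nonneg le_rfl (r + 2))
  have hA0 : 0 < ‖A‖ := norm_pos_iff.mpr hA
  obtain ⟨s, U, hs, hU, rfl⟩ :
      ∃ (s : ℝ) (U : Matrix (Fin d) (Fin d) ℝ), 0 < s ∧ ‖U‖ = 1 ∧ A = s • U :=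
    ⟨‖A‖, ‖A‖⁻¹ • A, hA0, by rw [norm_smul, norm_inv, norm_norm, inv_mul_cancel₀ hA0.ne'],
      by rw [smul_smul, mul_inv_cancel₀ hA0.ne', one_smul]⟩
  rw [Matrix.mul_smul, norm_rpow_smul_mul_transpose_smul hs, norm_rpow_smul_mul_transpose_smul hs,
    ← smul_sub, norm_smul, norm_smul, hU, Real.norm_of_nonneg hs.le, mul_one,
    Real.norm_of_nonneg (Real.rpow_nonneg hs.le _), mul_comm η]
  have := hB U hU
  rw [hU] at this
  gcongr

theorem eventually_det_pos_and_abs_det_rpow_sub_one_le {d : ℕ} (r : ℝ) {η : ℝ} (hη : 0 < η) :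
    ∀ᶠ B : Matrix (Fin d) (Fin d) ℝ in 𝓝 1, 0 < B.det ∧ |B.det ^ r - 1| ≤ η := by
  have hdet : ContinuousAt (fun B : Matrix (Fin d) (Fin d) ℝ => B.det) 1 :=
    (continuous_id.matrix_det).continuousAt
  have hc := ((hdet.rpow_const (p := r) (Or.inl (by simp))).sub_const 1).abs
  filter_upwards [hdet.eventually_const_lt (u := 0) (by simp),
    hc.eventually_lt_const (u := η) (by simpa using hη)] with B h₁ h₂
  exact ⟨h₁, h₂.le⟩

end

/-- Uniform-continuity-of-stress condition (2.3) of assumption (A1) for the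
Ogden-type example: for every `ε > 0` there is `δ > 0` such that `‖B − I‖ ≤ δ`
implies `‖K(BA) − K(A)‖ ≤ ε (1 + W_el(A))` for all `A` with `det A > 0`. -/
theorem stmt16 (d : ℕ) (hd : 1 ≤ d) (p q α c : ℝ)
    (hp : 2 ≤ p) (hq : 0 < q) (hα : 0 < α) (hc : 0 < c) :
    ∀ ε > (0 : ℝ), ∃ δ > (0 : ℝ), ∀ A B : Matrix (Fin d) (Fin d) ℝ,
      0 < A.det → fnorm (B - 1) ≤ δ →
      fnorm (Kstress p q α c (B * A) - Kstress p q α c A) ≤ ε * (1 + Wel p q α c A) := by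
  intro ε hε
  let _ := Matrix.frobeniusNormedAddCommGroup (m := Fin d) (n := Fin d) (α := ℝ)
  let _ := Matrix.frobeniusNormedSpace (m := Fin d) (n := Fin d) (α := ℝ) (R := ℝ)
  have hp0 : 0 < p := by linarith
  set N := ‖(1 : Matrix (Fin d) (Fin d) ℝ)‖ with hN
  have hN0 : 0 ≤ N := norm_nonneg _
  obtain ⟨δ, hδ, h⟩ := Metric.eventually_nhds_iff.mp
    ((eventually_norm_sub_le (d := d) (sub_nonneg.mpr hp) (div_pos hε hp0)).and
      (eventually_det_pos_and_abs_det_rpow_sub_one_le (d := d) (-q)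
        (η := ε / (q * (N + 1))) (by positivity)))
  refine ⟨δ / 2, half_pos hδ, fun A B hA hB => ?_⟩
  rw [fnorm_eq_norm, ← dist_eq_norm] at hB
  obtain ⟨h₁, hBpos, h₂⟩ := h (hB.trans_lt (half_lt_self hδ))
  have h₁ := h₁ A
  rw [sub_add_cancel] at h₁
  have hsplit : Kstress p q α c (B * A) - Kstress p q α c A =
      α • (‖B * A‖ ^ (p - 2) • ((B * A) * (B * A)ᵀ) - ‖A‖ ^ (p - 2) • (A * Aᵀ)) -
        (c * A.det ^ (-q) * (B.det ^ (-q) - 1)) • (1 : Matrix (Fin d) (Fin d) ℝ) := by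
    simp only [Kstress, fnorm_eq_norm, Matrix.det_mul, Real.mul_rpow hBpos.le hA.le]
    module
  have hD : 0 < A.det ^ (-q) := Real.rpow_pos_of_pos hA _
  rw [hsplit, Wel, fnorm_eq_norm, fnorm_eq_norm]
  refine (norm_sub_le _ _).trans ?_
  rw [norm_smul, norm_smul, Real.norm_of_nonneg hα.le, norm_mul (c * A.det ^ (-q)),
    Real.norm_of_nonneg (by positivity : 0 ≤ c * A.det ^ (-q)), Real.norm_eq_abs, ← hN]
  have e₁ : α * ‖‖B * A‖ ^ (p - 2) • ((B * A) * (B * A)ᵀ) - ‖A‖ ^ (p - 2) • (A * Aᵀ)‖ ≤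
      ε * (α / p * ‖A‖ ^ p) := by
    calc _ ≤ α * (ε / p * ‖A‖ ^ p) := by gcongr
      _ = _ := by ring
  have e₂ : c * A.det ^ (-q) * |B.det ^ (-q) - 1| * N ≤ ε * (c / q * A.det ^ (-q)) := by
    calc _ ≤ c * A.det ^ (-q) * (ε / (q * (N + 1))) * (N + 1) := by
          gcongr
          linarith
      _ = _ := by field_simp
  linarith
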